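/- Let (T,d) be a compact metric space and m a Borel probability measure on T. Let φ and ψ be Young functions with φ(1)=ψ(1)=1, and suppose there exist R>1 and an integer n₀≥1 such that (i) φ(R^k)/φ(R^{k+1}) ≤ φ(R^{k-1})/φ(R^k) for all integers k≥1, and (ii) Σ_{k=0}^{∞} φ(R^k)/ψ(R^{k+n₀}) < ∞. Assume moreover that ψ(x)ψ(y) ≤ ψ(rxy) for all x,y ≥ 1, for some r > 1. Set ψ₊(x) := max(ψ(x)−1, 0). Then there exist a Borel probability measure ν on T×T and a constant K ∈ (0,∞) depending only on φ, ψ, R, n₀ such that for every continuous function f : T → ℝ: sup_{s,t∈T, s≠t} ψ₊( |f(s)−f(t)| / (K r τ_{m,φ}(s,t)) ) ≤ ∫_{T×T} ψ₊(f^d(u,v)) ν(du,dv). -/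

import Mathlib

open MeasureTheory ENNReal Filter

noncomputable section

/-- A (finite) Young function: an increasing convex function `φ : [0,∞) → [0,∞)`
with `φ 0 = 0` and `φ x → ∞` as `x → ∞`. -/
def IsYoungFunction (φ : ℝ → ℝ) : Prop :=
  MonotoneOn φ (Set.Ici 0) ∧ ConvexOn ℝ (Set.Ici 0) φ ∧ φ 0 = 0 ∧
    Tendsto φ atTop atTop

/-- Generalized inverse of a Young function, as a map `ℝ≥0∞ → ℝ≥0∞`
(so that in particular `φ⁻¹(∞) = ∞`). -/
def yinv (φ : ℝ → ℝ) (y : ℝ≥0∞) : ℝ≥0∞ :=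
  sInf {x : ℝ≥0∞ | ∃ r : ℝ, 0 ≤ r ∧ x = ENNReal.ofReal r ∧ y ≤ ENNReal.ofReal (φ r)}

/-- The minorizing metric
`τ_{m,φ}(s,t) = max_{x ∈ {s,t}} ∫_0^{d(s,t)} φ⁻¹(1 / m(B(x,ε))) dε`,
with the conventions `1/0 = ∞`, `φ⁻¹(∞) = ∞`. -/
def tauDist {T : Type*} [MetricSpace T] [MeasurableSpace T]
    (m : Measure T) (φ : ℝ → ℝ) (s t : T) : ℝ≥0∞ :=
  max (∫⁻ ε in Set.Ioc (0 : ℝ) (dist s t), yinv φ (1 / m (Metric.closedBall s ε)))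
    (∫⁻ ε in Set.Ioc (0 : ℝ) (dist s t), yinv φ (1 / m (Metric.closedBall t ε)))

/-- `f^d(u,v) = |f(u) - f(v)| / d(u,v)`, equal to `0` on the diagonal. -/
def fdiv {T : Type*} [MetricSpace T] (f : T → ℝ) (p : T × T) : ℝ :=
  |f p.1 - f p.2| / dist p.1 p.2

/-- The Luxemburg norm `|g|^ν_χ = inf {a > 0 : ∫ χ(|g|/a) dν ≤ 1}`, with value `∞`
if no such `a` exists. -/
def luxNorm {X : Type*} [MeasurableSpace X] (ν : Measure X) (χ : ℝ → ℝ)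
    (g : X → ℝ) : ℝ≥0∞ :=
  sInf {a : ℝ≥0∞ | ∃ b : ℝ, 0 < b ∧ a = ENNReal.ofReal b ∧
    ∫⁻ u, ENNReal.ofReal (χ (|g u| / b)) ∂ν ≤ 1}

/-- The Amemiya norm `‖g‖^μ_χ = inf_{a>0} a (1 + ∫ χ(|g|/a) dμ)`. -/
def amemiyaNorm {X : Type*} [MeasurableSpace X] (μ : Measure X) (χ : ℝ → ℝ)
    (g : X → ℝ) : ℝ≥0∞ :=
  sInf {c : ℝ≥0∞ | ∃ a : ℝ, 0 < a ∧
    c = ENNReal.ofReal a * (1 + ∫⁻ u, ENNReal.ofReal (χ (|g u| / a)) ∂μ)}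

/-- `r_0(x) = D(T)` and, for `k ≥ 1`,
`r_k(x) = min {ε ≥ 0 : 1 / m(B(x,ε)) ≤ φ(R^k)}` (with `1/0 = ∞`). -/
def rad {T : Type*} [MetricSpace T] [MeasurableSpace T]
    (m : Measure T) (φ : ℝ → ℝ) (R : ℝ) : ℕ → T → ℝ
  | 0, _ => Metric.diam (Set.univ : Set T)
  | k + 1, x => sInf {ε : ℝ | 0 ≤ ε ∧
      1 / m (Metric.closedBall x ε) ≤ ENNReal.ofReal (φ (R ^ (k + 1)))}

/-- `r^l_k(x) = ∑_{i=k}^{l} 2^(i-k) r_i(x)`. -/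
def radl {T : Type*} [MetricSpace T] [MeasurableSpace T]
    (m : Measure T) (φ : ℝ → ℝ) (R : ℝ) (k l : ℕ) (x : T) : ℝ :=
  ∑ i ∈ Finset.Icc k l, (2 : ℝ) ^ (i - k) * rad m φ R i x

/-- The averaging operator `S_k f (x) = (1 / m(B_k(x))) ∫_{B_k(x)} f dm`,
with the convention `0/0 = 0`. -/
def avg {T : Type*} [MetricSpace T] [MeasurableSpace T]
    (m : Measure T) (φ : ℝ → ℝ) (R : ℝ) (k : ℕ) (f : T → ℝ) (x : T) : ℝ :=
  (∫ u in Metric.closedBall x (rad m φ R k x), f u ∂m) /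
    (m (Metric.closedBall x (rad m φ R k x))).toReal

/-- The iterated averaging operator `iterAvg k l f = S_l S_{l-1} ⋯ S_k f` (for `k ≤ l`). -/
def iterAvg {T : Type*} [MetricSpace T] [MeasurableSpace T]
    (m : Measure T) (φ : ℝ → ℝ) (R : ℝ) (k : ℕ) : ℕ → (T → ℝ) → T → ℝ
  | 0, f => avg m φ R 0 f
  | l + 1, f =>
      if l + 1 ≤ k then avg m φ R (l + 1) f
      else avg m φ R (l + 1) (iterAvg m φ R k l f)

/-- The set `{k ≥ 1 : B^l_k(s) ∪ B^l_k(t) ⊆ B°(u, r_{k-1}(u)) for every u ∈ B^l_k(x)}`,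
whose greatest element is `τ_x`. -/
def tauSet {T : Type*} [MetricSpace T] [MeasurableSpace T]
    (m : Measure T) (φ : ℝ → ℝ) (R : ℝ) (l : ℕ) (s t x : T) : Set ℕ :=
  {k : ℕ | 1 ≤ k ∧ ∀ u ∈ Metric.closedBall x (radl m φ R k l x),
    Metric.closedBall s (radl m φ R k l s) ∪ Metric.closedBall t (radl m φ R k l t) ⊆
      Metric.ball u (rad m φ R (k - 1) u)}

namespace IsYoungFunction

variable {φ : ℝ → ℝ}

lemma mul_le_mul (h : IsYoungFunction φ) {x y : ℝ} (hx : 0 ≤ x) (hxy : x ≤ y) :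
    φ x * y ≤ x * φ y := by
  obtain ⟨-, hc, h0, -⟩ := h
  rcases hx.eq_or_lt with rfl | hx'
  · simp [h0]
  have hy : 0 < y := hx'.trans_le hxy
  have h1 : x / y ≤ 1 := (div_le_one hy).2 hxy
  have := hc.2 (Set.mem_Ici.2 le_rfl) (Set.mem_Ici.2 hy.le) (sub_nonneg.2 h1)
    (div_nonneg hx hy.le) (sub_add_cancel 1 _)
  simp only [smul_eq_mul, mul_zero, zero_add, h0] at this
  rw [div_mul_cancel₀ _ hy.ne'] at this
  calc φ x * y ≤ (x / y * φ y) * y := by gcongr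
    _ = x * φ y := by field_simp

lemma self_le (h : IsYoungFunction φ) (h1 : φ 1 = 1) {x : ℝ} (hx : 1 ≤ x) : x ≤ φ x := by
  simpa [h1] using h.mul_le_mul zero_le_one hx

lemma le_self (h : IsYoungFunction φ) (h1 : φ 1 = 1) {x : ℝ} (h0 : 0 ≤ x) (hx : x ≤ 1) :
    φ x ≤ x := by
  simpa [h1] using h.mul_le_mul h0 hx

lemma le_mul_one_add_posPart (h : IsYoungFunction φ) (h1 : φ 1 = 1) {x ρ : ℝ}
    (hρ : 2 ≤ ρ) : x ≤ ρ * (1 + 2 / φ ρ * max (φ x - 1) 0) := by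
  have hφρ : ρ ≤ φ ρ := h.self_le h1 (by linarith)
  have hpos : 0 < φ ρ := by linarith
  rcases le_total x ρ with hle | hle
  · have : 0 ≤ 2 / φ ρ * max (φ x - 1) 0 := by positivity
    nlinarith
  · have h2 := h.mul_le_mul (by linarith) hle
    have h3 : x ≤ φ x := h.self_le h1 (by linarith)
    have h4 : φ x ≤ 2 * max (φ x - 1) 0 := by
      have := le_max_left (φ x - 1) 0
      linarith
    have h5 : x ≤ ρ * (φ x / φ ρ) := by
      rw [mul_div_assoc', le_div_iff₀ hpos]; linarith
    have h6 : φ x / φ ρ ≤ 2 / φ ρ * max (φ x - 1) 0 := by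
      rw [div_mul_eq_mul_div]; gcongr
    nlinarith

lemma ofReal_le_yinv (h : IsYoungFunction φ) {x : ℝ} (hx : 0 ≤ x) {y : ℝ≥0∞}
    (hy : ENNReal.ofReal (φ x) < y) : ENNReal.ofReal x ≤ yinv φ y := by
  refine le_sInf ?_
  rintro _ ⟨r, hr, rfl, hyr⟩
  refine ENNReal.ofReal_le_ofReal ?_
  by_contra! hlt
  have := h.1 (show r ∈ Set.Ici (0 : ℝ) from hr) (show x ∈ Set.Ici (0 : ℝ) from hx) hlt.le
  exact absurd (hy.trans_le (hyr.trans (ENNReal.ofReal_le_ofReal this))) (lt_irrefl _)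

lemma one_le_yinv (h : IsYoungFunction φ) (h1 : φ 1 = 1) {y : ℝ≥0∞} (hy : 1 ≤ y) :
    1 ≤ yinv φ y := by
  refine le_sInf ?_
  rintro _ ⟨r, hr, rfl, hyr⟩
  rw [ENNReal.one_le_ofReal]
  by_contra! hlt
  have := ENNReal.one_le_ofReal.1 (hy.trans hyr)
  linarith [h.le_self h1 hr hlt.le]

end IsYoungFunction

section QuantileRadius

variable {T : Type*} [MetricSpace T] [MeasurableSpace T]

/-- The smallest radius `ε` with `1 / m (B(x, ε)) ≤ M`. -/
def quantileRadius (m : Measure T) (M : ℝ≥0∞) (x : T) : ℝ :=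
  sInf {ε : ℝ | 0 ≤ ε ∧ 1 ≤ M * m (Metric.closedBall x ε)}

variable {m : Measure T} {M : ℝ≥0∞}

lemma quantileRadius_nonneg (x : T) : 0 ≤ quantileRadius m M x :=
  Real.sInf_nonneg fun _ h => h.1

lemma quantileRadius_le {x : T} {ε : ℝ} (h0 : 0 ≤ ε)
    (h : 1 ≤ M * m (Metric.closedBall x ε)) : quantileRadius m M x ≤ ε :=
  csInf_le ⟨0, fun _ h => h.1⟩ ⟨h0, h⟩

lemma mul_measure_closedBall_lt_one {x : T} {ε : ℝ} (h0 : 0 ≤ ε)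
    (h : ε < quantileRadius m M x) : M * m (Metric.closedBall x ε) < 1 := by
  by_contra! h'
  exact absurd (quantileRadius_le h0 h') h.not_ge

lemma mul_measure_ball_quantileRadius_le (x : T) :
    M * m (Metric.ball x (quantileRadius m M x)) ≤ 1 := by
  set ρ := quantileRadius m M x with hρ
  rcases (quantileRadius_nonneg (m := m) (M := M) x).eq_or_lt with h0 | h0
  · rw [hρ, ← h0]; simp
  obtain ⟨u, hu, hu', hlim⟩ := exists_seq_strictMono_tendsto' h0
  have hU : Metric.ball x ρ = ⋃ n, Metric.closedBall x (u n) := by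
    ext y
    simp only [Set.mem_iUnion, Metric.mem_closedBall, Metric.mem_ball]
    refine ⟨fun h => ?_, fun ⟨n, h⟩ => h.trans_lt (hu' n).2⟩
    obtain ⟨n, hn⟩ := ((tendsto_order.1 hlim).1 _ h).exists
    exact ⟨n, hn.le⟩
  rw [hU, Monotone.measure_iUnion
    (fun i j hij => Metric.closedBall_subset_closedBall (hu.monotone hij)), ENNReal.mul_iSup]
  exact iSup_le fun n => (mul_measure_closedBall_lt_one (hu' n).1.le (hu' n).2).le

variable [CompactSpace T] [IsProbabilityMeasure m]

lemma one_le_of_quantileRadius_lt (hM : 1 ≤ M) {x : T} {ε : ℝ}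
    (h : quantileRadius m M x < ε) : 1 ≤ M * m (Metric.closedBall x ε) := by
  have hne : {ε : ℝ | 0 ≤ ε ∧ 1 ≤ M * m (Metric.closedBall x ε)}.Nonempty := by
    refine ⟨Metric.diam (Set.univ : Set T), Metric.diam_nonneg, ?_⟩
    have : Metric.closedBall x (Metric.diam (Set.univ : Set T)) = Set.univ := by
      refine Set.eq_univ_of_forall fun y => ?_
      exact Metric.dist_le_diam_of_mem isCompact_univ.isBounded (Set.mem_univ _) (Set.mem_univ _)
    simpa [this] using hM
  obtain ⟨δ, hδ, hlt⟩ := exists_lt_of_csInf_lt hne h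
  exact hδ.2.trans (by gcongr)

lemma quantileRadius_le_add_dist (hM : 1 ≤ M) (x y : T) :
    quantileRadius m M x ≤ quantileRadius m M y + dist x y := by
  refine le_of_forall_pos_le_add fun δ hδ => ?_
  refine quantileRadius_le ?_ ((one_le_of_quantileRadius_lt hM
    (lt_add_of_pos_right (quantileRadius m M y) hδ)).trans ?_)
  · have := quantileRadius_nonneg (m := m) (M := M) y
    positivity
  · gcongr
    refine Metric.closedBall_subset_closedBall' ?_
    rw [dist_comm y x]; linarith

lemma continuous_quantileRadius (hM : 1 ≤ M) : Continuous (quantileRadius m M) :=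
  (LipschitzWith.of_le_add (quantileRadius_le_add_dist hM)).continuous

variable [BorelSpace T]

lemma one_le_mul_measure_closedBall_quantileRadius (hM : 1 ≤ M) (hM' : M ≠ ⊤) (x : T) :
    1 ≤ M * m (Metric.closedBall x (quantileRadius m M x)) := by
  set ρ := quantileRadius m M x
  obtain ⟨u, hu, hu', hlim⟩ := exists_seq_strictAnti_tendsto ρ
  have hI : ⋂ n, Metric.closedBall x (u n) = Metric.closedBall x ρ := by
    ext y
    simp only [Set.mem_iInter, Metric.mem_closedBall]
    exact ⟨fun h => ge_of_tendsto' hlim h, fun h n => h.trans (hu' n).le⟩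
  have ht : Tendsto (fun n => M * m (Metric.closedBall x (u n))) atTop
      (nhds (M * m (Metric.closedBall x ρ))) := by
    refine ENNReal.Tendsto.const_mul ?_ (Or.inr hM')
    rw [← hI]
    refine tendsto_measure_iInter_atTop (fun n => measurableSet_closedBall.nullMeasurableSet)
      (fun i j hij => Metric.closedBall_subset_closedBall (hu.antitone hij)) ⟨0, by simp⟩
  exact ge_of_tendsto' ht fun n => one_le_of_quantileRadius_lt hM (hu' n)

end QuantileRadius

section Kernel

variable {T : Type*} [MetricSpace T] [MeasurableSpace T]

/-- The density of the uniform law on the ball around `p.1` with quantile radius, at `p.2`. -/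
def ballKernel (m : Measure T) (M : ℝ≥0∞) (p : T × T) : ℝ≥0∞ :=
  {p : T × T | dist p.2 p.1 ≤ quantileRadius m M p.1}.indicator
    (fun p => (m (Metric.closedBall p.1 (quantileRadius m M p.1)))⁻¹) p

variable {m : Measure T} {M : ℝ≥0∞}

lemma dist_le_of_ballKernel_ne_zero {p : T × T} (h : ballKernel m M p ≠ 0) :
    dist p.2 p.1 ≤ quantileRadius m M p.1 := by
  by_contra hlt
  exact h (by simp [ballKernel, hlt])

/-- The density `M` on the pairs with `d(u, v)` less than the quantile radius of `u`. -/
def openBallKernel (m : Measure T) (M : ℝ≥0∞) (p : T × T) : ℝ≥0∞ :=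
  {p : T × T | dist p.2 p.1 < quantileRadius m M p.1}.indicator (fun _ => M) p

lemma lintegral_openBallKernel_le [BorelSpace T] (x : T) : ∫⁻ y, openBallKernel m M (x, y) ∂m ≤ 1 := by
  have : ∀ y, openBallKernel m M (x, y) =
      (Metric.ball x (quantileRadius m M x)).indicator (fun _ => M) y := fun y => by
    simp [openBallKernel, Set.indicator, Metric.mem_ball]
  simp_rw [this]
  rw [lintegral_indicator_const measurableSet_ball]
  exact mul_measure_ball_quantileRadius_le x

variable [CompactSpace T] [IsProbabilityMeasure m] [BorelSpace T]

lemma measurable_ballKernel (hM : 1 ≤ M) : Measurable (ballKernel m M) := by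
  have hS : MeasurableSet {p : T × T | dist p.2 p.1 ≤ quantileRadius m M p.1} :=
    (isClosed_le (by fun_prop) ((continuous_quantileRadius hM).comp continuous_fst)).measurableSet
  refine Measurable.indicator ?_ hS
  exact ((measurable_measure_prodMk_left (ν := m) hS).comp measurable_fst).inv

lemma ballKernel_le (hM : 1 ≤ M) (hM' : M ≠ ⊤) (p : T × T) : ballKernel m M p ≤ M := by
  refine Set.indicator_apply_le' (fun _ => ?_) fun _ => zero_le
  have := one_le_mul_measure_closedBall_quantileRadius (m := m) hM hM' p.1
  rwa [ENNReal.inv_le_iff_le_mul (fun h => absurd h hM') (fun h => absurd h (measure_ne_top _ _)),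
    mul_comm]

lemma lintegral_ballKernel (hM : 1 ≤ M) (hM' : M ≠ ⊤) (x : T) :
    ∫⁻ y, ballKernel m M (x, y) ∂m = 1 := by
  have h1 := one_le_mul_measure_closedBall_quantileRadius (m := m) hM hM' x
  have h0 : m (Metric.closedBall x (quantileRadius m M x)) ≠ 0 := fun h => by simp [h] at h1
  have : ∀ y, ballKernel m M (x, y) =
      (Metric.closedBall x (quantileRadius m M x)).indicator
        (fun _ => (m (Metric.closedBall x (quantileRadius m M x)))⁻¹) y := fun y => by
    simp [ballKernel, Set.indicator, Metric.mem_closedBall]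
  simp_rw [this]
  rw [lintegral_indicator_const measurableSet_closedBall,
    ENNReal.inv_mul_cancel h0 (measure_ne_top _ _)]

lemma lintegral_const_mul_ballKernel (hM : 1 ≤ M) (hM' : M ≠ ⊤) (c : ℝ≥0∞) (x : T) :
    ∫⁻ y, c * ballKernel m M (x, y) ∂m = c := by
  have h : Measurable fun y => ballKernel m M (x, y) :=
    (measurable_ballKernel hM).comp measurable_prodMk_left
  rw [lintegral_const_mul _ h, lintegral_ballKernel hM hM', mul_one]

lemma measurable_openBallKernel (hM : 1 ≤ M) : Measurable (openBallKernel m M) :=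
  measurable_const.indicator
    (isOpen_lt (by fun_prop) ((continuous_quantileRadius hM).comp continuous_fst)).measurableSet

end Kernel

section Increment

lemma fdiv_nonneg {T : Type*} [MetricSpace T] {f : T → ℝ} (p : T × T) : 0 ≤ fdiv f p := by
  unfold fdiv; positivity

lemma edist_eq_fdiv_mul {T : Type*} [MetricSpace T] {f : T → ℝ} (u v : T) :
    edist (f u) (f v) = ENNReal.ofReal (fdiv f (u, v)) * ENNReal.ofReal (dist u v) := by
  rw [← ENNReal.ofReal_mul (fdiv_nonneg _), edist_dist, Real.dist_eq, fdiv]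
  rcases eq_or_ne u v with rfl | h
  · simp
  · rw [div_mul_cancel₀ _ (dist_ne_zero.2 h)]

variable {T : Type*} [MetricSpace T] [MeasurableSpace T]

/-- The integrand `ψ₊ (f^d)`. -/
def youngIncrement (ψ : ℝ → ℝ) (f : T → ℝ) (p : T × T) : ℝ≥0∞ :=
  ENNReal.ofReal (max (ψ (fdiv f p) - 1) 0)

variable {ψ : ℝ → ℝ} {f : T → ℝ}

variable [CompactSpace T] [BorelSpace T]

lemma measurable_youngIncrement (hψ : IsYoungFunction ψ) (hf : Continuous f) :
    Measurable (youngIncrement ψ f) := by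
  have hmono : Monotone fun x => ψ (max x 0) := fun x y hxy =>
    hψ.1 (Set.mem_Ici.2 (le_max_right _ _)) (Set.mem_Ici.2 (le_max_right _ _)) (max_le_max_right _ hxy)
  have hfd : Measurable (fdiv f) := by
    have h1 : Measurable fun p : T × T => |f p.1 - f p.2| :=
      Continuous.measurable (by fun_prop)
    have h2 : Measurable fun p : T × T => dist p.1 p.2 := Continuous.measurable (by fun_prop)
    exact h1.div h2
  have : Measurable fun p => ψ (fdiv f p) := by
    simpa [Function.comp_def, fdiv_nonneg] using hmono.measurable.comp hfd
  exact ((this.sub_const 1).max measurable_const).ennreal_ofReal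

variable {m : Measure T}

lemma lintegral_mul_edist_le (hψ : IsYoungFunction ψ) (hψ1 : ψ 1 = 1) (hf : Continuous f)
    {θ W : T × T → ℝ≥0∞} (hθm : Measurable θ) (hW : Measurable W)
    (hθ : ∫⁻ p, θ p ∂(m.prod m) ≤ 1) {N : ℝ≥0∞} (hN : ∀ p, θ p ≤ N * W p) {E : ℝ}
    (hE : ∀ p, θ p ≠ 0 → dist p.1 p.2 ≤ E) {ρ : ℝ} (hρ : 2 ≤ ρ) :
    ∫⁻ p, θ p * edist (f p.1) (f p.2) ∂(m.prod m) ≤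
      ENNReal.ofReal E * ENNReal.ofReal ρ *
        (1 + ENNReal.ofReal (2 / ψ ρ) * N * ∫⁻ p, W p * youngIncrement ψ f p ∂(m.prod m)) := by
  have hH := measurable_youngIncrement hψ hf
  have hpt : ∀ p, θ p * edist (f p.1) (f p.2) ≤
      ENNReal.ofReal E * ENNReal.ofReal ρ *
        (θ p + ENNReal.ofReal (2 / ψ ρ) * N * (W p * youngIncrement ψ f p)) := by
    intro p
    rcases eq_or_ne (θ p) 0 with h0 | h0
    · simp [h0]
    have h1 : edist (f p.1) (f p.2) ≤ ENNReal.ofReal E * ENNReal.ofReal ρ *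
        (1 + ENNReal.ofReal (2 / ψ ρ) * youngIncrement ψ f p) := by
      have hψρ : 0 < ψ ρ := by linarith [hψ.self_le hψ1 (by linarith : (1 : ℝ) ≤ ρ)]
      rw [edist_eq_fdiv_mul, mul_comm, mul_assoc]
      refine mul_le_mul' (ENNReal.ofReal_le_ofReal (hE p h0)) ?_
      rw [youngIncrement, ← ENNReal.ofReal_mul (by positivity), ← ENNReal.ofReal_one,
        ← ENNReal.ofReal_add zero_le_one (by positivity), ← ENNReal.ofReal_mul (by linarith)]
      exact ENNReal.ofReal_le_ofReal (hψ.le_mul_one_add_posPart hψ1 hρ)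
    calc θ p * edist (f p.1) (f p.2) ≤ θ p * (ENNReal.ofReal E * ENNReal.ofReal ρ *
        (1 + ENNReal.ofReal (2 / ψ ρ) * youngIncrement ψ f p)) := by gcongr
      _ = ENNReal.ofReal E * ENNReal.ofReal ρ *
        (θ p + ENNReal.ofReal (2 / ψ ρ) * (θ p * youngIncrement ψ f p)) := by ring
      _ ≤ ENNReal.ofReal E * ENNReal.ofReal ρ *
        (θ p + ENNReal.ofReal (2 / ψ ρ) * (N * W p * youngIncrement ψ f p)) := by
        gcongr; exact hN p
      _ = _ := by ring
  refine (lintegral_mono hpt).trans ?_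
  rw [lintegral_const_mul _ (by fun_prop), lintegral_add_left hθm,
    lintegral_const_mul _ (by fun_prop)]
  gcongr

variable [IsProbabilityMeasure m] {M : ℝ≥0∞}

/-- One step of the random walk `q ↦ ∫ q(u) w(u, ·) dm(u)` with `w` the ball kernel. -/
lemma exists_density_step (hψ : IsYoungFunction ψ) (hψ1 : ψ 1 = 1) (hf : Continuous f)
    (hM : 1 ≤ M) (hM' : M ≠ ⊤) {N : ℝ≥0∞} {q : T → ℝ≥0∞} (hq : Measurable q)
    (hq1 : ∫⁻ u, q u ∂m = 1) (hqN : ∀ u, q u ≤ N) {x : T} {D D' : ℝ}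
    (hqD : ∀ u, q u ≠ 0 → dist u x ≤ D) (hD' : quantileRadius m M x + 2 * D ≤ D') (hD : 0 ≤ D)
    {ρ : ℝ} (hρ : 2 ≤ ρ) :
    ∃ q' : T → ℝ≥0∞, Measurable q' ∧ ∫⁻ u, q' u ∂m = 1 ∧ (∀ u, q' u ≤ M) ∧
      (∀ u, q' u ≠ 0 → dist u x ≤ D') ∧
      ∀ c, ∫⁻ u, q u * edist (f u) c ∂m ≤ ENNReal.ofReal D' * ENNReal.ofReal ρ *
        (1 + ENNReal.ofReal (2 / ψ ρ) * N *
          ∫⁻ p, ballKernel m M p * youngIncrement ψ f p ∂(m.prod m)) +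
        ∫⁻ u, q' u * edist (f u) c ∂m := by
  have hw := measurable_ballKernel (m := m) hM
  have hw1 := lintegral_const_mul_ballKernel (m := m) hM hM'
  have hθm : Measurable fun p : T × T => q p.1 * ballKernel m M p := by fun_prop
  have hrad : ∀ u v, q u ≠ 0 → ballKernel m M (u, v) ≠ 0 →
      dist v u ≤ quantileRadius m M x + D := fun u v h1 h2 => by
    have h3 : dist v u ≤ quantileRadius m M u := dist_le_of_ballKernel_ne_zero h2
    have h4 := quantileRadius_le_add_dist (m := m) hM u x
    linarith [hqD u h1]
  refine ⟨fun v => ∫⁻ u, q u * ballKernel m M (u, v) ∂m, hθm.lintegral_prod_left', ?_, ?_, ?_, ?_⟩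
  · rw [lintegral_lintegral_swap (by exact (hθm.comp measurable_swap).aemeasurable)]
    simp_rw [hw1, hq1]
  · intro v
    calc ∫⁻ u, q u * ballKernel m M (u, v) ∂m ≤ ∫⁻ u, q u * M ∂m :=
          lintegral_mono fun u => by gcongr; exact ballKernel_le hM hM' _
      _ = M := by rw [lintegral_mul_const _ hq, hq1, one_mul]
  · intro v hv
    by_contra! hlt
    refine hv ?_
    have : ∀ u, q u * ballKernel m M (u, v) = 0 := fun u => by
      by_contra hne
      rw [mul_eq_zero, not_or] at hne
      have h1 := hrad u v hne.1 hne.2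
      have h2 := hqD u hne.1
      have h3 := dist_triangle v u x
      linarith
    simp [this]
  · intro c
    have hfe : Measurable fun p : T × T => edist (f p.1) (f p.2) :=
      Continuous.measurable (by fun_prop)
    have hfc : Measurable fun u => edist (f u) c := Continuous.measurable (by fun_prop)
    have hθ1 : ∫⁻ p, q p.1 * ballKernel m M p ∂(m.prod m) ≤ 1 := by
      rw [lintegral_prod _ hθm.aemeasurable]
      simp_rw [hw1, hq1, le_refl]
    have hkey := lintegral_mul_edist_le hψ hψ1 hf hθm hw hθ1 (N := N)
      (fun p => by gcongr; exact hqN _) (E := D') (fun p hp => by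
        rw [mul_ne_zero_iff] at hp
        rw [dist_comm]
        linarith [hrad p.1 p.2 hp.1 hp.2]) hρ
    refine le_trans ?_ (add_le_add_left hkey _)
    have hswap : ∫⁻ v, (∫⁻ u, q u * ballKernel m M (u, v) ∂m) * edist (f v) c ∂m =
        ∫⁻ p, q p.1 * ballKernel m M p * edist (f p.2) c ∂(m.prod m) := by
      rw [lintegral_prod_symm _ (by fun_prop)]
      refine lintegral_congr fun v => ?_
      exact (lintegral_mul_const _ (hθm.comp measurable_prodMk_right)).symm
    have hfst : ∫⁻ u, q u * edist (f u) c ∂m =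
        ∫⁻ p, q p.1 * ballKernel m M p * edist (f p.1) c ∂(m.prod m) := by
      rw [lintegral_prod _ (by fun_prop)]
      refine lintegral_congr fun u => ?_
      simp_rw [mul_right_comm (q u)]
      rw [hw1]
    rw [hswap, hfst, ← lintegral_add_left (by fun_prop)]
    refine lintegral_mono fun p => ?_
    rw [← mul_add]
    gcongr
    exact edist_triangle _ _ _

end Increment

section Chaining

variable {T : Type*} [MetricSpace T] [CompactSpace T] [MeasurableSpace T] [BorelSpace T]
  {m : Measure T} [IsProbabilityMeasure m] {ψ : ℝ → ℝ} {f : T → ℝ}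

lemma exists_chain_density (hψ : IsYoungFunction ψ) (hψ1 : ψ 1 = 1) (hf : Continuous f)
    {M : ℕ → ℝ≥0∞} (hM : ∀ k, 1 ≤ M k) (hM' : ∀ k, M k ≠ ⊤) {ρ : ℕ → ℝ} (hρ : ∀ k, 2 ≤ ρ k)
    {x : T} {l : ℕ} {D : ℕ → ℝ} (hD : ∀ k, 0 ≤ D k)
    (hDr : ∀ k ≤ l, quantileRadius m (M k) x + 2 * D (k + 1) ≤ D k) {ε : ℝ≥0∞}
    (hε : ∀ u, dist u x ≤ quantileRadius m (M l) x → edist (f u) (f x) ≤ ε)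
    (n k : ℕ) (hk : k + n = l) :
    ∃ q : T → ℝ≥0∞, Measurable q ∧ ∫⁻ u, q u ∂m = 1 ∧ (∀ u, q u ≤ M k) ∧
      (∀ u, q u ≠ 0 → dist u x ≤ D k) ∧
      ∀ c, edist (f x) c ≤ (ε + ∑ j ∈ Finset.Ico k l, ENNReal.ofReal (D j) * ENNReal.ofReal (ρ j) *
        (1 + ENNReal.ofReal (2 / ψ (ρ j)) * M (j + 1) *
          ∫⁻ p, ballKernel m (M j) p * youngIncrement ψ f p ∂(m.prod m))) +
        ∫⁻ u, q u * edist (f u) c ∂m := by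
  induction n generalizing k with
  | zero =>
    obtain rfl : k = l := by omega
    have hw : Measurable fun u => ballKernel m (M k) (x, u) :=
      (measurable_ballKernel (hM k)).comp measurable_prodMk_left
    have hw1 := lintegral_const_mul_ballKernel (m := m) (hM k) (hM' k)
    have hdist : ∀ u, ballKernel m (M k) (x, u) ≠ 0 → dist u x ≤ quantileRadius m (M k) x :=
      fun u hu => dist_le_of_ballKernel_ne_zero hu
    refine ⟨fun u => ballKernel m (M k) (x, u), hw, lintegral_ballKernel (hM k) (hM' k) x,
      fun u => ballKernel_le (hM k) (hM' k) _, fun u hu => ?_, fun c => ?_⟩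
    · linarith [hdist u hu, hDr k le_rfl, hD (k + 1)]
    · have hfc : Measurable fun u => edist (f u) c := Continuous.measurable (by fun_prop)
      simp only [Finset.Ico_self, Finset.sum_empty, add_zero]
      calc edist (f x) c = ∫⁻ u, edist (f x) c * ballKernel m (M k) (x, u) ∂m := (hw1 _ x).symm
        _ ≤ ∫⁻ u, (ε * ballKernel m (M k) (x, u) +
            ballKernel m (M k) (x, u) * edist (f u) c) ∂m := ?_
        _ = _ := by rw [lintegral_add_left (by fun_prop), hw1]
      refine lintegral_mono fun u => ?_
      rw [mul_comm ε, mul_comm, ← mul_add]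
      rcases eq_or_ne (ballKernel m (M k) (x, u)) 0 with h0 | h0
      · simp [h0]
      · gcongr
        refine (edist_triangle _ (f u) _).trans ?_
        rw [edist_comm (f x)]
        gcongr
        exact hε u (hdist u h0)
  | succ n ih =>
    obtain ⟨q, hq, hq1, hqM, hqD, hqc⟩ := ih (k + 1) (by omega)
    obtain ⟨q', hq', hq1', hqM', hqD', hqc'⟩ := exists_density_step hψ hψ1 hf (hM k) (hM' k) hq hq1
      hqM hqD (hDr k (by omega)) (hD _) (hρ k)
    refine ⟨q', hq', hq1', hqM', hqD', fun c => (hqc c).trans ?_⟩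
    rw [Finset.sum_eq_sum_Ico_succ_bot (by omega : k < l)]
    refine (add_le_add_right (hqc' c) _).trans (le_of_eq ?_)
    ring

lemma edist_le_of_densities (hf : Continuous f) {qs qt : T → ℝ≥0∞} (hqs : Measurable qs)
    (hqt : Measurable qt) (hqs1 : ∫⁻ u, qs u ∂m = 1)
    {s t : T} {As At : ℝ≥0∞}
    (hs : ∀ c, edist (f s) c ≤ As + ∫⁻ u, qs u * edist (f u) c ∂m)
    (ht : ∀ c, edist (f t) c ≤ At + ∫⁻ u, qt u * edist (f u) c ∂m) :
    edist (f s) (f t) ≤ As + At +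
      ∫⁻ p, qs p.1 * qt p.2 * edist (f p.1) (f p.2) ∂(m.prod m) := by
  have hfe : Measurable fun p : T × T => edist (f p.1) (f p.2) :=
    Continuous.measurable (by fun_prop)
  refine (hs (f t)).trans ?_
  rw [add_assoc]
  gcongr
  have h1 : At = ∫⁻ u, qs u * At ∂m := by rw [lintegral_mul_const _ hqs, hqs1, one_mul]
  rw [h1, lintegral_prod _ (by fun_prop), ← lintegral_add_left (by fun_prop)]
  refine lintegral_mono fun u => ?_
  simp_rw [mul_assoc]
  have hm : Measurable fun v => qt v * edist (f u) (f v) :=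
    hqt.mul (Continuous.measurable (by fun_prop))
  rw [lintegral_const_mul _ hm, ← mul_add]
  gcongr
  simpa only [edist_comm] using ht (f u)

end Chaining

section Radii

lemma sum_pow_mul_le_of_recursion {R : ℝ} (hR : 12 ≤ R) {e b D : ℕ → ℝ} {l k₀ : ℕ}
    (hD : ∀ k, 0 ≤ D k) (hDl : D (l + 1) = 0)
    (hrec : ∀ k, k₀ ≤ k → k ≤ l → D k = e k + 2 * D (k + 1))
    (he : ∀ k, k₀ ≤ k → k ≤ l → e k ≤ 4 * D (k + 1) + 4 * b k) (n k : ℕ) (hk : k₀ ≤ k)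
    (hn : k + n = l + 1) :
    ∑ j ∈ Finset.Ico k (l + 1), R ^ j * D j + R ^ k * D k ≤
      8 * ∑ j ∈ Finset.Ico k (l + 1), R ^ j * b j := by
  induction n generalizing k with
  | zero =>
    obtain rfl : k = l + 1 := by omega
    simp [hDl]
  | succ n ih =>
    have h1 := ih (k + 1) (by omega) (by omega)
    have h2 := hrec k hk (by omega)
    have h3 := he k hk (by omega)
    have hsum := fun g : ℕ → ℝ => Finset.sum_eq_sum_Ico_succ_bot (by omega : k < l + 1) g
    rw [hsum, hsum]
    have h4 : 2 * (R ^ k * D k) ≤ R ^ (k + 1) * D (k + 1) + 8 * (R ^ k * b k) := by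
      have hRk : 0 ≤ R ^ k := by positivity
      have h5 : 2 * D k ≤ R * D (k + 1) + 8 * b k := by nlinarith [hD (k + 1)]
      calc 2 * (R ^ k * D k) = R ^ k * (2 * D k) := by ring
        _ ≤ R ^ k * (R * D (k + 1) + 8 * b k) := by gcongr
        _ = _ := by ring
    linarith

/-- The dyadically weighted tail sum `∑_{i = k}^{l} 2 ^ (i - k) ρ i`. -/
def tailRadius (ρ : ℕ → ℝ) (l k : ℕ) : ℝ :=
  ∑ i ∈ Finset.range (l + 1 - k), 2 ^ i * ρ (k + i)

lemma tailRadius_nonneg {ρ : ℕ → ℝ} (hρ : ∀ k, 0 ≤ ρ k) (l k : ℕ) : 0 ≤ tailRadius ρ l k :=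
  Finset.sum_nonneg fun i _ => mul_nonneg (by positivity) (hρ _)

lemma tailRadius_eq (ρ : ℕ → ℝ) {l k : ℕ} (h : k ≤ l) :
    tailRadius ρ l k = ρ k + 2 * tailRadius ρ l (k + 1) := by
  have : l + 1 - k = (l + 1 - (k + 1)) + 1 := by omega
  rw [tailRadius, this, Finset.sum_range_succ', tailRadius, Finset.mul_sum]
  simp only [pow_zero, one_mul, add_zero]
  rw [add_comm]
  congr 1
  refine Finset.sum_congr rfl fun i _ => ?_
  rw [show k + (i + 1) = k + 1 + i by ring]
  ring

lemma tailRadius_succ_self (ρ : ℕ → ℝ) (l : ℕ) : tailRadius ρ l (l + 1) = 0 := by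
  simp [tailRadius]

lemma exists_joining_level {R d : ℝ} (hR : 12 ≤ R) (hd : 0 < d) {ρs ρt : ℕ → ℝ}
    (hs : ∀ k, 0 ≤ ρs k) (ht : ∀ k, 0 ≤ ρt k) (hst : ∀ k, ρt k ≤ ρs k + d) {l : ℕ} (hl : 1 ≤ l)
    (hsl : ρs l ≤ d) (htl : ρt l ≤ d) :
    ∃ k₀, 1 ≤ k₀ ∧ k₀ ≤ l ∧
      (k₀ = 1 ∨ 2 * tailRadius ρs l k₀ + tailRadius ρt l k₀ + d < ρs (k₀ - 1)) ∧
      ∑ j ∈ Finset.Ico k₀ (l + 1), R ^ j * (tailRadius ρs l j + tailRadius ρt l j) ≤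
        8 * ∑ j ∈ Finset.Ico 1 (l + 1), R ^ j * (min (ρs j) d + min (ρt j) d) := by
  classical
  set P : ℕ → Prop := fun k =>
    k = 1 ∨ 2 * tailRadius ρs l k + tailRadius ρt l k + d < ρs (k - 1) with hP
  have hP1 : P 1 := Or.inl rfl
  have hk1 : 1 ≤ Nat.findGreatest P l := Nat.le_findGreatest hl hP1
  have hkl : Nat.findGreatest P l ≤ l := Nat.findGreatest_le l
  refine ⟨Nat.findGreatest P l, hk1, hkl, Nat.findGreatest_spec hl hP1, ?_⟩
  have hfail : ∀ k, Nat.findGreatest P l < k → k ≤ l →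
      ρs (k - 1) ≤ 2 * tailRadius ρs l k + tailRadius ρt l k + d := fun k h1 h2 => by
    have := Nat.findGreatest_is_greatest h1 h2
    rw [hP, not_or, not_lt] at this
    exact this.2
  generalize Nat.findGreatest P l = k₀ at *
  have hb : ∀ k, 0 ≤ min (ρs k) d + min (ρt k) d := fun k =>
    add_nonneg (le_min (hs k) hd.le) (le_min (ht k) hd.le)
  have hmain := sum_pow_mul_le_of_recursion hR (e := fun k => ρs k + ρt k)
    (b := fun k => min (ρs k) d + min (ρt k) d)
    (D := fun k => tailRadius ρs l k + tailRadius ρt l k) (l := l) (k₀ := k₀)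
    (fun k => add_nonneg (tailRadius_nonneg hs _ _) (tailRadius_nonneg ht _ _))
    (by simp [tailRadius_succ_self])
    (fun k _ h => by simp only [tailRadius_eq _ h]; ring)
    (fun k h1 h2 => by
      have hDs := tailRadius_nonneg hs l (k + 1)
      have hDt := tailRadius_nonneg ht l (k + 1)
      by_cases hle : ρs k ≤ d ∧ ρt k ≤ d
      · rw [min_eq_left hle.1, min_eq_left hle.2]
        linarith [hs k, ht k]
      · have hbd : d ≤ min (ρs k) d + min (ρt k) d := by
          rw [not_and_or, not_le, not_le] at hle
          rcases hle with h | h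
          · rw [min_eq_right h.le]; linarith [le_min (ht k) hd.le]
          · rw [min_eq_right h.le]; linarith [le_min (hs k) hd.le]
        have hkl' : k < l := by
          refine lt_of_le_of_ne h2 ?_
          rintro rfl
          exact hle ⟨hsl, htl⟩
        have h3 := hfail (k + 1) (by omega) hkl'
        rw [Nat.add_sub_cancel] at h3
        linarith [hst k])
    (l + 1 - k₀) k₀ le_rfl (by omega)
  have h0 : 0 ≤ R ^ k₀ * (tailRadius ρs l k₀ + tailRadius ρt l k₀) :=
    mul_nonneg (by positivity) (add_nonneg (tailRadius_nonneg hs _ _) (tailRadius_nonneg ht _ _))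
  have hsub : ∑ j ∈ Finset.Ico k₀ (l + 1), R ^ j * (min (ρs j) d + min (ρt j) d) ≤
      ∑ j ∈ Finset.Ico 1 (l + 1), R ^ j * (min (ρs j) d + min (ρt j) d) :=
    Finset.sum_le_sum_of_subset_of_nonneg (Finset.Ico_subset_Ico_left hk1)
      fun j _ _ => mul_nonneg (by positivity) (hb j)
  linarith

lemma ofReal_mul_le_lintegral_Ioc {h : ℝ → ℝ≥0∞} {c d : ℝ} (hc : 0 ≤ c)
    (hh : ∀ ε, 0 < ε → ε < d → ENNReal.ofReal c ≤ h ε) :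
    ENNReal.ofReal (c * d) ≤ ∫⁻ ε in Set.Ioc 0 d, h ε := by
  calc ENNReal.ofReal (c * d) = ∫⁻ _ in Set.Ioo 0 d, ENNReal.ofReal c := by
        simp [ENNReal.ofReal_mul hc]
    _ ≤ ∫⁻ ε in Set.Ioo 0 d, h ε :=
        setLIntegral_mono' measurableSet_Ioo fun ε hε => hh ε hε.1 hε.2
    _ ≤ _ := lintegral_mono_set Set.Ioo_subset_Ioc_self

lemma sum_pow_le_two_mul_pow {R : ℝ} (hR : 2 ≤ R) (l : ℕ) :
    ∑ j ∈ Finset.Ico 1 (l + 1), R ^ j ≤ 2 * R ^ l := by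
  induction l with
  | zero => simp
  | succ l ih =>
    rw [Finset.sum_Ico_succ_top (by omega), pow_succ]
    have : 0 ≤ R ^ l := by positivity
    nlinarith

variable {T : Type*} [MetricSpace T] [MeasurableSpace T] {m : Measure T} [IsFiniteMeasure m] {φ : ℝ → ℝ}

lemma ofReal_le_yinv_of_lt_quantileRadius (hφ : IsYoungFunction φ) {y : ℝ} (hy : 0 ≤ y) {x : T}
    {ε : ℝ} (h0 : 0 ≤ ε) (hε : ε < quantileRadius m (ENNReal.ofReal (φ y)) x) :
    ENNReal.ofReal y ≤ yinv φ (1 / m (Metric.closedBall x ε)) := by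
  refine hφ.ofReal_le_yinv hy ?_
  have h := mul_measure_closedBall_lt_one h0 hε
  rw [ENNReal.lt_div_iff_mul_lt (Or.inr ENNReal.ofReal_ne_top)
    (Or.inl (measure_ne_top _ _))]
  exact h

lemma sum_pow_mul_min_quantileRadius_le (hφ : IsYoungFunction φ) {R : ℝ} (hR : 2 ≤ R) (x : T)
    {d a : ℝ} (ha : 0 ≤ a)
    (hint : ∫⁻ ε in Set.Ioc 0 d, yinv φ (1 / m (Metric.closedBall x ε)) ≤ ENNReal.ofReal a)
    (hd : 0 ≤ d) (l : ℕ) :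
    ∑ j ∈ Finset.Ico 1 (l + 1),
      R ^ j * min (quantileRadius m (ENNReal.ofReal (φ (R ^ j))) x) d ≤ 2 * a := by
  set ρ : ℕ → ℝ := fun j => quantileRadius m (ENNReal.ofReal (φ (R ^ j))) x with hρ
  have hpt : ∀ ε, 0 < ε → ∑ j ∈ Finset.Ico 1 (l + 1),
      (Set.Iio (ρ j)).indicator (fun _ => ENNReal.ofReal (R ^ j)) ε ≤
        2 * yinv φ (1 / m (Metric.closedBall x ε)) := by
    intro ε hε
    induction l with
    | zero => simp
    | succ l ih =>
      by_cases hlt : ε < ρ (l + 1)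
      · calc ∑ j ∈ Finset.Ico 1 (l + 1 + 1),
            (Set.Iio (ρ j)).indicator (fun _ => ENNReal.ofReal (R ^ j)) ε
            ≤ ∑ j ∈ Finset.Ico 1 (l + 1 + 1), ENNReal.ofReal (R ^ j) :=
              Finset.sum_le_sum fun j _ => Set.indicator_le_self (Set.Iio (ρ j)) (fun _ => ENNReal.ofReal (R ^ j)) ε
          _ = ENNReal.ofReal (∑ j ∈ Finset.Ico 1 (l + 1 + 1), R ^ j) :=
              (ENNReal.ofReal_sum_of_nonneg fun j _ => by positivity).symm
          _ ≤ ENNReal.ofReal (2 * R ^ (l + 1)) :=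
              ENNReal.ofReal_le_ofReal (sum_pow_le_two_mul_pow hR _)
          _ = 2 * ENNReal.ofReal (R ^ (l + 1)) := by
              rw [ENNReal.ofReal_mul (by norm_num)]; simp
          _ ≤ _ := by
              gcongr
              exact ofReal_le_yinv_of_lt_quantileRadius hφ (by positivity) hε.le hlt
      · rw [Finset.sum_Ico_succ_top (by omega), Set.indicator_of_notMem (by simpa using hlt),
          add_zero]
        exact ih
  have hρ0 : ∀ j, 0 ≤ min (ρ j) d := fun j => le_min (quantileRadius_nonneg _) hd
  have hterm : ∀ j, ENNReal.ofReal (R ^ j * min (ρ j) d) ≤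
      ∫⁻ ε in Set.Ioc 0 d, (Set.Iio (ρ j)).indicator (fun _ => ENNReal.ofReal (R ^ j)) ε := by
    intro j
    rw [lintegral_indicator measurableSet_Iio, setLIntegral_const,
      Measure.restrict_apply measurableSet_Iio, ENNReal.ofReal_mul (by positivity)]
    gcongr
    calc ENNReal.ofReal (min (ρ j) d) = volume (Set.Ioo 0 (min (ρ j) d)) := by simp
      _ ≤ volume (Set.Iio (ρ j) ∩ Set.Ioc 0 d) := measure_mono fun ε hε => ⟨hε.2.trans_le (min_le_left _ _), hε.1,
          (hε.2.trans_le (min_le_right _ _)).le⟩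
  rw [← ENNReal.ofReal_le_ofReal_iff (by positivity),
    ENNReal.ofReal_sum_of_nonneg fun j _ => mul_nonneg (by positivity) (hρ0 j)]
  calc _ ≤ ∑ j ∈ Finset.Ico 1 (l + 1),
        ∫⁻ ε in Set.Ioc 0 d, (Set.Iio (ρ j)).indicator (fun _ => ENNReal.ofReal (R ^ j)) ε :=
        Finset.sum_le_sum fun j _ => hterm j
    _ = ∫⁻ ε in Set.Ioc 0 d, ∑ j ∈ Finset.Ico 1 (l + 1),
        (Set.Iio (ρ j)).indicator (fun _ => ENNReal.ofReal (R ^ j)) ε :=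
        (lintegral_finsetSum _ fun j _ => measurable_const.indicator measurableSet_Iio).symm
    _ ≤ ∫⁻ ε in Set.Ioc 0 d, 2 * yinv φ (1 / m (Metric.closedBall x ε)) :=
        setLIntegral_mono' measurableSet_Ioc fun ε hε => hpt ε hε.1
    _ = 2 * ∫⁻ ε in Set.Ioc 0 d, yinv φ (1 / m (Metric.closedBall x ε)) :=
        lintegral_const_mul' _ _ (by norm_num)
    _ ≤ 2 * ENNReal.ofReal a := by gcongr
    _ = ENNReal.ofReal (2 * a) := by rw [ENNReal.ofReal_mul (by norm_num)]; simp

end Radii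

section ChainMeasure

variable {T : Type*} [MetricSpace T] [MeasurableSpace T]

/-- The kernel used to join, at level `k`, the random walks started from two points. -/
def joinKernel (m : Measure T) (M : ℕ → ℝ≥0∞) (k : ℕ) (p : T × T) : ℝ≥0∞ :=
  if k ≤ 1 then 1 else openBallKernel m (M (k - 1)) p

/-- The weight of level `k` in `chainMeasure`. -/
def levelWeight (ψ : ℝ → ℝ) (M : ℕ → ℝ≥0∞) (ρ : ℕ → ℝ) (k : ℕ) : ℝ≥0∞ :=
  ENNReal.ofReal (2 / ψ (ρ k)) * M (k + 1)

/-- The unnormalized measure on `T × T` controlling the increments of all continuous functions. -/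
def chainMeasure (m : Measure T) (ψ : ℝ → ℝ) (M : ℕ → ℝ≥0∞) (ρ : ℕ → ℝ) : Measure (T × T) :=
  (m.prod m).withDensity fun p =>
    ∑' k, levelWeight ψ M ρ k * (ballKernel m (M k) p + joinKernel m M k p)

lemma mul_le_mul_joinKernel {m : Measure T} {M : ℕ → ℝ≥0∞} {k : ℕ} (hk : 1 ≤ k)
    (hlog : M k * M k ≤ M (k + 1) * M (k - 1)) {p : T × T}
    (hp : k = 1 ∨ dist p.2 p.1 < quantileRadius m (M (k - 1)) p.1) (h0 : M 0 = 1) :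
    M k * M k ≤ M (k + 1) * joinKernel m M k p := by
  rcases hk.eq_or_lt with rfl | hk1
  · simpa [joinKernel, h0] using hlog
  · have hlt := hp.resolve_left (by omega)
    have : joinKernel m M k p = M (k - 1) := by
      simp [joinKernel, openBallKernel, hlt, hk1.not_ge]
    rwa [this]

variable [CompactSpace T] [BorelSpace T] {m : Measure T} [IsProbabilityMeasure m]
  {M : ℕ → ℝ≥0∞} {ψ : ℝ → ℝ} {ρ : ℕ → ℝ}

lemma measurable_joinKernel (hM : ∀ k, 1 ≤ M k) (k : ℕ) : Measurable (joinKernel m M k) := by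
  by_cases h : k ≤ 1
  · have : joinKernel m M k = fun _ => 1 := funext fun p => by simp [joinKernel, h]
    rw [this]; exact measurable_const
  · have : joinKernel m M k = openBallKernel m (M (k - 1)) :=
      funext fun p => by simp [joinKernel, h]
    rw [this]; exact measurable_openBallKernel (hM _)

lemma lintegral_ballKernel_prod (hM : ∀ k, 1 ≤ M k) (hM' : ∀ k, M k ≠ ⊤) (k : ℕ) :
    ∫⁻ p, ballKernel m (M k) p ∂(m.prod m) = 1 := by
  rw [lintegral_prod _ (measurable_ballKernel (hM k)).aemeasurable]
  simp [lintegral_ballKernel (hM k) (hM' k)]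

lemma lintegral_joinKernel_prod_le (hM : ∀ k, 1 ≤ M k) (k : ℕ) :
    ∫⁻ p, joinKernel m M k p ∂(m.prod m) ≤ 1 := by
  rw [lintegral_prod _ (measurable_joinKernel hM k).aemeasurable]
  calc _ ≤ ∫⁻ _ : T, 1 ∂m := lintegral_mono fun x => by
        by_cases h : k ≤ 1
        · simp [joinKernel, h]
        · simpa [joinKernel, h] using lintegral_openBallKernel_le (m := m) (M := M (k - 1)) x
    _ = 1 := by simp

lemma lintegral_chainMeasure (hM : ∀ k, 1 ≤ M k) {H : T × T → ℝ≥0∞} (hH : Measurable H) :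
    ∫⁻ p, H p ∂(chainMeasure m ψ M ρ) =
      ∑' k, levelWeight ψ M ρ k * (∫⁻ p, ballKernel m (M k) p * H p ∂(m.prod m) +
        ∫⁻ p, joinKernel m M k p * H p ∂(m.prod m)) := by
  have hb := fun k => measurable_ballKernel (m := m) (hM k)
  have hj := fun k => measurable_joinKernel (m := m) hM k
  rw [chainMeasure, lintegral_withDensity_eq_lintegral_mul _ (by fun_prop) hH]
  simp only [Pi.mul_apply, ← ENNReal.tsum_mul_right]
  rw [lintegral_tsum fun k => by fun_prop]
  refine tsum_congr fun k => ?_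
  rw [← lintegral_add_left (by fun_prop), ← lintegral_const_mul _ (by fun_prop)]
  refine lintegral_congr fun p => ?_
  ring

lemma chainMeasure_univ_le (hM : ∀ k, 1 ≤ M k) (hM' : ∀ k, M k ≠ ⊤) :
    chainMeasure m ψ M ρ Set.univ ≤ 2 * ∑' k, levelWeight ψ M ρ k := by
  rw [← lintegral_one, lintegral_chainMeasure hM measurable_const, ← ENNReal.tsum_mul_left]
  refine ENNReal.tsum_le_tsum fun k => ?_
  simp only [mul_one]
  rw [mul_comm, lintegral_ballKernel_prod hM hM', ← one_add_one_eq_two]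
  gcongr
  exact lintegral_joinKernel_prod_le hM k

lemma levelWeight_le_chainMeasure_univ (hM : ∀ k, 1 ≤ M k) (hM' : ∀ k, M k ≠ ⊤) (k : ℕ) :
    levelWeight ψ M ρ k ≤ chainMeasure m ψ M ρ Set.univ := by
  rw [← lintegral_one, lintegral_chainMeasure hM measurable_const]
  refine le_trans ?_ (ENNReal.le_tsum k)
  simp only [mul_one]
  rw [lintegral_ballKernel_prod hM hM', mul_add, mul_one]
  exact le_self_add

end ChainMeasure

lemma ENNReal.sum_weighted_le {ι : Type*} {S : Finset ι} {x z : ι → ℝ≥0∞} {B : ℝ≥0∞}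
    (hx : ∑ j ∈ S, x j ≤ B) : ∑ j ∈ S, x j * (1 + z j) ≤ B * (1 + ∑ j ∈ S, z j) := by
  calc ∑ j ∈ S, x j * (1 + z j) = ∑ j ∈ S, x j + ∑ j ∈ S, x j * z j := by
        simp_rw [mul_add, mul_one, Finset.sum_add_distrib]
    _ ≤ B + ∑ j ∈ S, B * z j := by
        gcongr with j hj
        exact (Finset.single_le_sum (fun _ _ => zero_le) hj).trans hx
    _ = _ := by rw [mul_add, mul_one, Finset.mul_sum]

section Main

lemma quantileRadius_lt_of_sum_le {T : Type*} [MetricSpace T] [MeasurableSpace T]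
    {m : Measure T} {R a δ d : ℝ} (hR : 12 ≤ R) (hd : 0 < d) {M : ℕ → ℝ≥0∞} {x : T}
    {l : ℕ} (hl : 1 ≤ l) (hla : 2 * a < R ^ l * min d δ)
    (hsum : ∑ j ∈ Finset.Ico 1 (l + 1), R ^ j * min (quantileRadius m (M j) x) d ≤ 2 * a) :
    quantileRadius m (M l) x < min d δ := by
  have h1 : R ^ l * min (quantileRadius m (M l) x) d ≤ 2 * a :=
    (Finset.single_le_sum (f := fun j => R ^ j * min (quantileRadius m (M j) x) d)
      (fun j _ => mul_nonneg (by positivity) (le_min (quantileRadius_nonneg _) hd.le))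
      (Finset.mem_Ico.2 ⟨hl, by omega⟩)).trans hsum
  have h2 := lt_of_mul_lt_mul_left (h1.trans_lt hla) (by positivity)
  rcases min_lt_iff.1 h2 with h | h
  · exact h
  · exact absurd (h.trans_le (min_le_left _ _)) (lt_irrefl _)

variable {T : Type*} [MetricSpace T] [CompactSpace T] [MeasurableSpace T] [BorelSpace T]
  {m : Measure T} [IsProbabilityMeasure m] {φ ψ : ℝ → ℝ} {f : T → ℝ}

lemma edist_le_lintegral_chainMeasure (hφ : IsYoungFunction φ) (hφ1 : φ 1 = 1)
    (hψ : IsYoungFunction ψ) (hψ1 : ψ 1 = 1) {R : ℝ} (hR : 12 ≤ R) (n₀ : ℕ)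
    (hlog : ∀ k, φ (R ^ (k + 1)) * φ (R ^ (k + 1)) ≤ φ (R ^ (k + 2)) * φ (R ^ k))
    (hf : Continuous f) {s t : T} (hst : s ≠ t) {a : ℝ} (ha : 0 < a)
    (hτ : tauDist m φ s t ≤ ENNReal.ofReal a) :
    edist (f s) (f t) ≤ ENNReal.ofReal (2 * (R ^ (1 + n₀) * (32 + R) * a)) *
      (1 + ∫⁻ p, youngIncrement ψ f p ∂(chainMeasure m ψ (fun k => ENNReal.ofReal (φ (R ^ k)))
        fun k => R ^ (k + 1 + n₀))) := by
  set M : ℕ → ℝ≥0∞ := fun k => ENNReal.ofReal (φ (R ^ k)) with hMdef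
  set ρ : ℕ → ℝ := fun k => R ^ (k + 1 + n₀) with hρdef
  set B : ℝ := R ^ (1 + n₀) * (32 + R) * a with hB
  set d := dist s t with hd_def
  have hd : 0 < d := dist_pos.2 hst
  have hR1 : ∀ k : ℕ, 1 ≤ R ^ k := fun k => one_le_pow₀ (by linarith)
  have hφ1' : ∀ k : ℕ, 1 ≤ φ (R ^ k) := fun k => (hR1 k).trans (hφ.self_le hφ1 (hR1 k))
  have hM : ∀ k, 1 ≤ M k := fun k => ENNReal.one_le_ofReal.2 (hφ1' k)
  have hM' : ∀ k, M k ≠ ⊤ := fun k => ENNReal.ofReal_ne_top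
  have hM0 : M 0 = 1 := by simp [hMdef, hφ1]
  have hρ : ∀ k, 2 ≤ ρ k := fun k => by
    have : R ^ (k + 1 + n₀) = R ^ (k + n₀) * R := by ring
    rw [hρdef]; simp only [this]; nlinarith [hR1 (k + n₀)]
  have hτs := (le_max_left _ _).trans hτ
  have hτt := (le_max_right _ _).trans hτ
  have hsums := sum_pow_mul_min_quantileRadius_le hφ (by linarith : (2 : ℝ) ≤ R) s ha.le hτs hd.le
  have hsumt := sum_pow_mul_min_quantileRadius_le hφ (by linarith : (2 : ℝ) ≤ R) t ha.le hτt hd.le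
  refine ENNReal.le_of_forall_pos_le_add fun ε hε _ => ?_
  have hε2 : 0 < ε / 2 := by positivity
  have hcont : ∀ x : T, ∃ δ > 0, ∀ u, dist u x < δ → edist (f u) (f x) ≤ (ε / 2 : NNReal) := by
    intro x
    obtain ⟨δ, hδ, h⟩ := Metric.continuousAt_iff.1 hf.continuousAt (ε / 2 : NNReal) hε2
    exact ⟨δ, hδ, fun u hu => by
      rw [edist_nndist]; exact_mod_cast (h hu).le⟩
  obtain ⟨δs, hδs, hfs⟩ := hcont s
  obtain ⟨δt, hδt, hft⟩ := hcont t
  have hδ : 0 < min d (min δs δt) := lt_min hd (lt_min hδs hδt)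
  obtain ⟨l, hl1, hl⟩ : ∃ l : ℕ, 1 ≤ l ∧ 2 * a < R ^ l * min d (min δs δt) := by
    have := (tendsto_pow_atTop_atTop_of_one_lt (by linarith : 1 < R)).atTop_mul_const hδ
    exact ((eventually_ge_atTop 1).and (this.eventually_gt_atTop (2 * a))).exists
  have hls := quantileRadius_lt_of_sum_le (M := M) hR hd hl1 hl (hsums l)
  have hlt := quantileRadius_lt_of_sum_le (M := M) hR hd hl1 hl (hsumt l)
  rw [lt_min_iff, lt_min_iff] at hls hlt
  set rs : ℕ → ℝ := fun k => quantileRadius m (M k) s with hrs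
  set rt : ℕ → ℝ := fun k => quantileRadius m (M k) t with hrt
  have hrs0 : ∀ k, 0 ≤ rs k := fun k => quantileRadius_nonneg s
  have hrt0 : ∀ k, 0 ≤ rt k := fun k => quantileRadius_nonneg t
  obtain ⟨k, hk1, hkl, hjoin, hsum⟩ := exists_joining_level hR hd hrs0 hrt0
    (fun k => by rw [hd_def, dist_comm]; exact quantileRadius_le_add_dist (hM k) t s)
    hl1 hls.1.le hlt.1.le
  set Ds := tailRadius rs l
  set Dt := tailRadius rt l
  have hDs0 : ∀ k, 0 ≤ Ds k := tailRadius_nonneg hrs0 l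
  have hDt0 : ∀ k, 0 ≤ Dt k := tailRadius_nonneg hrt0 l
  have hsum' : ∑ j ∈ Finset.Ico k (l + 1), R ^ j * (Ds j + Dt j) ≤ 32 * a := by
    simp_rw [mul_add, Finset.sum_add_distrib] at hsum ⊢
    linarith [hsums l, hsumt l]
  have hRd : R ^ k * d ≤ R * a := by
    have h : R ^ (k - 1) * d ≤ a := by
      rw [← ENNReal.ofReal_le_ofReal_iff ha.le]
      refine (ofReal_mul_le_lintegral_Ioc (by positivity) fun ε h0 h1 => ?_).trans hτs
      rcases hjoin with rfl | hlt
      · simpa using hφ.one_le_yinv hφ1 (by simpa using prob_le_one)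
      · refine ofReal_le_yinv_of_lt_quantileRadius hφ (by positivity) h0.le ?_
        linarith [hDs0 k, hDt0 k]
    obtain ⟨i, rfl⟩ : ∃ i, k = i + 1 := ⟨k - 1, by omega⟩
    rw [Nat.add_sub_cancel] at h
    calc R ^ (i + 1) * d = R * (R ^ i * d) := by ring
      _ ≤ R * a := by gcongr
  obtain ⟨qs, hqs, hqs1, hqsM, hqsD, hqsc⟩ := exists_chain_density (m := m) hψ hψ1 hf hM hM' hρ
    (x := s) hDs0 (fun k hk => (tailRadius_eq rs hk).ge)
    (fun u hu => hfs u (hu.trans_lt hls.2.1)) (l - k) k (by omega)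
  obtain ⟨qt, hqt, hqt1, hqtM, hqtD, hqtc⟩ := exists_chain_density (m := m) hψ hψ1 hf hM hM' hρ
    (x := t) hDt0 (fun k hk => (tailRadius_eq rt hk).ge)
    (fun u hu => hft u (hu.trans_lt hlt.2.2)) (l - k) k (by omega)
  have hlogM : M k * M k ≤ M (k + 1) * M (k - 1) := by
    obtain ⟨i, rfl⟩ : ∃ i, k = i + 1 := ⟨k - 1, by omega⟩
    have hpos : ∀ k : ℕ, 0 ≤ φ (R ^ k) := fun k => zero_le_one.trans (hφ1' k)
    simp only [hMdef, Nat.add_sub_cancel]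
    rw [← ENNReal.ofReal_mul (hpos _), ← ENNReal.ofReal_mul (hpos _)]
    exact ENNReal.ofReal_le_ofReal (hlog i)
  have hθdist : ∀ p : T × T, qs p.1 * qt p.2 ≠ 0 →
      dist p.1 s ≤ Ds k ∧ dist p.2 t ≤ Dt k := fun p hp => by
    rw [mul_ne_zero_iff] at hp
    exact ⟨hqsD _ hp.1, hqtD _ hp.2⟩
  have hθE : ∀ p : T × T, qs p.1 * qt p.2 ≠ 0 → dist p.1 p.2 ≤ Ds k + Dt k + d := fun p hp => by
    obtain ⟨h1, h2⟩ := hθdist p hp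
    have := dist_triangle4 p.1 s t p.2
    rw [dist_comm t] at this
    linarith
  have hjoint := lintegral_mul_edist_le (m := m) hψ hψ1 hf (θ := fun p => qs p.1 * qt p.2)
    (W := joinKernel m M k) (by fun_prop) (measurable_joinKernel hM k)
    (by rw [lintegral_prod_mul hqs.aemeasurable hqt.aemeasurable, hqs1, hqt1, one_mul])
    (N := M (k + 1))
    (fun p => by
      rcases eq_or_ne (qs p.1 * qt p.2) 0 with h0 | h0
      · simp [h0]
      refine (mul_le_mul' (hqsM _) (hqtM _)).trans
        (mul_le_mul_joinKernel hk1 hlogM (hjoin.imp_right fun hlt => ?_) hM0)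
      obtain ⟨h1, h2⟩ := hθdist p h0
      have h3 := hθE p h0
      have h4 := quantileRadius_le_add_dist (m := m) (hM (k - 1)) s p.1
      rw [dist_comm] at h3
      rw [dist_comm] at h4
      simp only [hrs] at hlt
      linarith)
    hθE (hρ k)
  have htot := edist_le_of_densities hf hqs hqt hqs1 hqsc hqtc
  set H := youngIncrement ψ f
  have hHm : Measurable H := measurable_youngIncrement hψ hf
  set z : ℕ → ℝ≥0∞ := fun j => levelWeight ψ M ρ j * ∫⁻ p, ballKernel m (M j) p * H p ∂(m.prod m)
  set y : ℕ → ℝ≥0∞ := fun j => levelWeight ψ M ρ j * ∫⁻ p, joinKernel m M j p * H p ∂(m.prod m)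
  have hI : ∫⁻ p, H p ∂(chainMeasure m ψ M ρ) = ∑' j, z j + ∑' j, y j := by
    rw [lintegral_chainMeasure hM hHm, ← ENNReal.tsum_add]
    simp_rw [mul_add, z, y]
  have hρeq : ∀ j, ρ j = R ^ (1 + n₀) * R ^ j := fun j => by simp only [hρdef]; ring
  have hR0 : 0 ≤ R ^ (1 + n₀) := by positivity
  have hρ0 : ∀ j, 0 ≤ ρ j := fun j => by linarith [hρ j]
  have hxB : ∑ j ∈ Finset.Ico k l, (ENNReal.ofReal (Ds j) * ENNReal.ofReal (ρ j) +
      ENNReal.ofReal (Dt j) * ENNReal.ofReal (ρ j)) ≤ ENNReal.ofReal B := by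
    have hterm : ∀ j, ENNReal.ofReal (Ds j) * ENNReal.ofReal (ρ j) +
        ENNReal.ofReal (Dt j) * ENNReal.ofReal (ρ j) =
        ENNReal.ofReal (R ^ (1 + n₀) * (R ^ j * (Ds j + Dt j))) := fun j => by
      rw [← add_mul, ← ENNReal.ofReal_add (hDs0 j) (hDt0 j),
        ← ENNReal.ofReal_mul (add_nonneg (hDs0 j) (hDt0 j)), hρeq]
      congr 1; ring
    have h0 : ∀ j, 0 ≤ R ^ j * (Ds j + Dt j) := fun j =>
      mul_nonneg (by positivity) (add_nonneg (hDs0 j) (hDt0 j))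
    simp_rw [hterm]
    rw [← ENNReal.ofReal_sum_of_nonneg fun j _ => mul_nonneg hR0 (h0 j), ← Finset.mul_sum]
    refine ENNReal.ofReal_le_ofReal ?_
    rw [hB, mul_assoc]
    refine mul_le_mul_of_nonneg_left ?_ hR0
    have := Finset.sum_le_sum_of_subset_of_nonneg (f := fun j => R ^ j * (Ds j + Dt j))
      (Finset.Ico_subset_Ico_right (a := k) (Nat.le_succ l)) fun j _ _ => h0 j
    rw [Nat.succ_eq_add_one] at this
    nlinarith
  have hEB : ENNReal.ofReal (Ds k + Dt k + d) * ENNReal.ofReal (ρ k) ≤ ENNReal.ofReal B := by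
    rw [← ENNReal.ofReal_mul' (hρ0 k)]
    refine ENNReal.ofReal_le_ofReal ?_
    have h1 : R ^ k * (Ds k + Dt k) ≤ 32 * a :=
      (Finset.single_le_sum (f := fun j => R ^ j * (Ds j + Dt j))
        (fun j _ => mul_nonneg (by positivity) (add_nonneg (hDs0 j) (hDt0 j)))
        (Finset.mem_Ico.2 ⟨le_rfl, by omega⟩)).trans hsum'
    calc (Ds k + Dt k + d) * ρ k = R ^ (1 + n₀) * (R ^ k * (Ds k + Dt k) + R ^ k * d) := by
          rw [hρeq]; ring
      _ ≤ R ^ (1 + n₀) * (32 * a + R * a) := by gcongr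
      _ = B := by rw [hB]; ring
  have hzy : (1 + ∑ j ∈ Finset.Ico k l, z j) + (1 + y k) ≤ 2 * (1 + (∑' j, z j + ∑' j, y j)) := by
    calc _ ≤ (1 + ∑' j, z j) + (1 + ∑' j, y j) := by
          gcongr
          · exact ENNReal.sum_le_tsum _
          · exact ENNReal.le_tsum k
      _ = 2 + 1 * (∑' j, z j + ∑' j, y j) := by ring
      _ ≤ 2 + 2 * (∑' j, z j + ∑' j, y j) := by gcongr; norm_num
      _ = _ := by ring
  have hεε : ((ε / 2 : NNReal) : ℝ≥0∞) + (ε / 2 : NNReal) = ε := by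
    rw [← ENNReal.coe_add, add_halves]
  rw [hI]
  calc edist (f s) (f t) ≤ _ := htot
    _ ≤ _ := add_le_add_right hjoint _
    _ = (∑ j ∈ Finset.Ico k l, (ENNReal.ofReal (Ds j) * ENNReal.ofReal (ρ j) +
          ENNReal.ofReal (Dt j) * ENNReal.ofReal (ρ j)) * (1 + z j) +
        ENNReal.ofReal (Ds k + Dt k + d) * ENNReal.ofReal (ρ k) * (1 + y k)) +
        (((ε / 2 : NNReal) : ℝ≥0∞) + (ε / 2 : NNReal)) := by
      simp_rw [add_mul (ENNReal.ofReal (Ds _) * ENNReal.ofReal (ρ _)), Finset.sum_add_distrib]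
      simp only [z, y, levelWeight]
      abel
    _ ≤ (ENNReal.ofReal B * (1 + ∑ j ∈ Finset.Ico k l, z j) + ENNReal.ofReal B * (1 + y k)) + ε := by
      rw [hεε]
      gcongr
      exact ENNReal.sum_weighted_le hxB
    _ ≤ ENNReal.ofReal B * (2 * (1 + (∑' j, z j + ∑' j, y j))) + ε := by
      rw [← mul_add]; gcongr
    _ = _ := by
      rw [ENNReal.ofReal_mul (by norm_num : (0 : ℝ) ≤ 2), ENNReal.ofReal_ofNat]
      ring

end Main

lemma mul_le_mul_of_logConvex {a : ℕ → ℝ} (ha : ∀ k, 0 < a k)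
    (hlog : ∀ k, a (k + 1) * a (k + 1) ≤ a (k + 2) * a k) {n n' : ℕ} (hn : n ≤ n') (i : ℕ) :
    a (n + i) * a n' ≤ a (n' + i) * a n := by
  have hq : Monotone fun k => a (k + 1) / a k := monotone_nat_of_le_succ fun k => by
    rw [div_le_div_iff₀ (ha _) (ha _)]
    exact hlog k
  rw [← div_le_div_iff₀ (ha _) (ha _)]
  induction i with
  | zero => simp [(ha _).ne']
  | succ i ih =>
    have h (n : ℕ) : a (n + (i + 1)) / a n = a (n + i + 1) / a (n + i) * (a (n + i) / a n) := by
      rw [div_mul_div_cancel₀ (ha _).ne', add_assoc]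
    rw [h, h]
    exact mul_le_mul (hq (by omega)) ih (div_pos (ha _) (ha _)).le (div_pos (ha _) (ha _)).le

/-- The linear form of the increment bound: it is a consequence of chaining when `R` is large. -/
theorem exists_measure_edist_le {φ ψ : ℝ → ℝ} (hφ : IsYoungFunction φ) (hφ1 : φ 1 = 1)
    (hψ : IsYoungFunction ψ) (hψ1 : ψ 1 = 1) {R : ℝ} (hR : 12 ≤ R) (n₀ : ℕ)
    (hlog : ∀ k, φ (R ^ (k + 1)) * φ (R ^ (k + 1)) ≤ φ (R ^ (k + 2)) * φ (R ^ k))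
    (hsum : Summable fun k : ℕ => φ (R ^ (k + 1)) / ψ (R ^ (k + 1 + n₀))) :
    ∃ C : ℝ, 0 < C ∧
      ∀ (T : Type) [MetricSpace T] [CompactSpace T] [MeasurableSpace T] [BorelSpace T]
        (m : Measure T), IsProbabilityMeasure m →
          ∃ ν : Measure (T × T), IsProbabilityMeasure ν ∧
            ∀ f : T → ℝ, Continuous f → ∀ s t : T, s ≠ t →
              ∀ a : ℝ, 0 < a → tauDist m φ s t ≤ ENNReal.ofReal a →
                edist (f s) (f t) ≤ ENNReal.ofReal (C * a) * (1 + ∫⁻ p, youngIncrement ψ f p ∂ν) := by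
  have hR1 : ∀ k : ℕ, 1 ≤ R ^ k := fun k => one_le_pow₀ (by linarith)
  have hφ1' : ∀ k : ℕ, 1 ≤ φ (R ^ k) := fun k => (hR1 k).trans (hφ.self_le hφ1 (hR1 k))
  have hψ1' : ∀ k : ℕ, 0 < ψ (R ^ k) := fun k => by linarith [hR1 k, hψ.self_le hψ1 (hR1 k)]
  have hq0 : ∀ k : ℕ, 0 ≤ φ (R ^ (k + 1)) / ψ (R ^ (k + 1 + n₀)) := fun k =>
    div_nonneg (by linarith [hφ1' (k + 1)]) (hψ1' _).le
  set Λ : ℝ := ∑' k : ℕ, φ (R ^ (k + 1)) / ψ (R ^ (k + 1 + n₀)) with hΛ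
  have hΛ0 : 0 ≤ Λ := tsum_nonneg hq0
  set M : ℕ → ℝ≥0∞ := fun k => ENNReal.ofReal (φ (R ^ k)) with hMdef
  set ρ : ℕ → ℝ := fun k => R ^ (k + 1 + n₀) with hρdef
  have hM : ∀ k, 1 ≤ M k := fun k => ENNReal.one_le_ofReal.2 (hφ1' k)
  have hM' : ∀ k, M k ≠ ⊤ := fun k => ENNReal.ofReal_ne_top
  have hweight : ∀ k, levelWeight ψ M ρ k =
      2 * ENNReal.ofReal (φ (R ^ (k + 1)) / ψ (R ^ (k + 1 + n₀))) := fun k => by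
    rw [levelWeight, ← ENNReal.ofReal_mul (div_nonneg (by norm_num) (hψ1' _).le),
      ← ENNReal.ofReal_ofNat 2, ← ENNReal.ofReal_mul (by norm_num)]
    congr 1; ring
  have htsum : ∑' k, levelWeight ψ M ρ k = 2 * ENNReal.ofReal Λ := by
    simp_rw [hweight]
    rw [ENNReal.tsum_mul_left, hΛ, ENNReal.ofReal_tsum_of_nonneg hq0 hsum]
  refine ⟨2 * (R ^ (1 + n₀) * (32 + R)) * (1 + 4 * Λ), by positivity, ?_⟩
  intro T _ _ _ _ m _
  set ν₀ := chainMeasure m ψ M ρ with hν₀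
  have hZle : ν₀ Set.univ ≤ ENNReal.ofReal (4 * Λ) := by
    refine (chainMeasure_univ_le hM hM').trans_eq ?_
    rw [htsum, ENNReal.ofReal_mul (by norm_num), ENNReal.ofReal_ofNat, ← mul_assoc]
    norm_num
  have hZ0 : ν₀ Set.univ ≠ 0 := by
    refine (lt_of_lt_of_le ?_ (levelWeight_le_chainMeasure_univ hM hM' 0)).ne'
    rw [hweight]
    have : 0 < φ (R ^ (0 + 1)) / ψ (R ^ (0 + 1 + n₀)) :=
      div_pos (by linarith [hφ1' (0 + 1)]) (hψ1' _)
    simpa using this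
  have hZt : ν₀ Set.univ ≠ ⊤ := ne_top_of_le_ne_top ENNReal.ofReal_ne_top hZle
  refine ⟨(ν₀ Set.univ)⁻¹ • ν₀, ⟨?_⟩, fun f hf s t hst a ha hτ => ?_⟩
  · simp [ENNReal.inv_mul_cancel hZ0 hZt]
  · refine (edist_le_lintegral_chainMeasure hφ hφ1 hψ hψ1 hR n₀ hlog hf hst ha hτ).trans ?_
    rw [← hMdef, ← hρdef, ← hν₀, lintegral_smul_measure, smul_eq_mul]
    set I := ∫⁻ p, youngIncrement ψ f p ∂ν₀
    have hI : I ≤ ENNReal.ofReal (4 * Λ) * ((ν₀ Set.univ)⁻¹ * I) := by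
      calc I = ν₀ Set.univ * ((ν₀ Set.univ)⁻¹ * I) := by
            rw [← mul_assoc, ENNReal.mul_inv_cancel hZ0 hZt, one_mul]
        _ ≤ _ := by gcongr
    have h1 : 1 + I ≤ ENNReal.ofReal (1 + 4 * Λ) * (1 + (ν₀ Set.univ)⁻¹ * I) := by
      rw [ENNReal.ofReal_add zero_le_one (by positivity), ENNReal.ofReal_one, add_mul, one_mul,
        mul_add (ENNReal.ofReal (4 * Λ))]
      refine (add_le_add_right hI 1).trans ?_
      rw [add_assoc]
      gcongr
      exact le_add_left le_add_self
    refine (mul_le_mul_right h1 _).trans_eq ?_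
    rw [← mul_assoc, ← ENNReal.ofReal_mul (by positivity)]
    congr 2
    ring

lemma youngIncrement_div_le {T : Type*} [MetricSpace T] {ψ : ℝ → ℝ} (hψ : IsYoungFunction ψ)
    (hψ1 : ψ 1 = 1) {r : ℝ} (hr : 1 < r)
    (hψr : ∀ x y : ℝ, 1 ≤ x → 1 ≤ y → ψ x * ψ y ≤ ψ (r * x * y)) (f : T → ℝ) {y : ℝ} (hy : 1 ≤ y)
    (p : T × T) :
    youngIncrement ψ (fun u => f u / (r * y)) p ≤
      ENNReal.ofReal (1 / ψ y) * youngIncrement ψ f p := by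
  have hψy : 1 ≤ ψ y := hy.trans (hψ.self_le hψ1 hy)
  have hry : 0 < r * y := by positivity
  have hX : fdiv f p = r * fdiv (fun u => f u / (r * y)) p * y := by
    simp only [fdiv, ← sub_div, abs_div, abs_of_pos hry]
    field_simp
  set X := fdiv (fun u => f u / (r * y)) p with hXdef
  rw [youngIncrement, youngIncrement, ← ENNReal.ofReal_mul (by positivity), ← hXdef, hX]
  refine ENNReal.ofReal_le_ofReal (max_le ?_ (by positivity))
  rcases le_total X 1 with h | h
  · have h1 : ψ X ≤ X := hψ.le_self hψ1 (fdiv_nonneg _) h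
    refine le_trans (by linarith) (by positivity : (0 : ℝ) ≤ _)
  · have h1 := hψr X y h hy
    refine le_trans ?_ (mul_le_mul_of_nonneg_left (le_max_left _ _) (by positivity))
    rw [one_div_mul_eq_div, le_div_iff₀ (by linarith)]
    nlinarith

lemma ofReal_posPart_le_of_edist_le {T : Type*} [MetricSpace T] [MeasurableSpace T]
    {ψ : ℝ → ℝ} (hψ : IsYoungFunction ψ)
    (hψ1 : ψ 1 = 1) {r : ℝ} (hr : 1 < r)
    (hψr : ∀ x y : ℝ, 1 ≤ x → 1 ≤ y → ψ x * ψ y ≤ ψ (r * x * y)) {ν : Measure (T × T)} {b : ℝ}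
    (hb : 0 < b) {s t : T} {f : T → ℝ}
    (h : ∀ c : ℝ, edist (f s / c) (f t / c) ≤
      ENNReal.ofReal b * (1 + ∫⁻ p, youngIncrement ψ (fun u => f u / c) p ∂ν)) :
    ENNReal.ofReal (max (ψ (|f s - f t| / (2 * b * r)) - 1) 0) ≤
      ∫⁻ p, youngIncrement ψ f p ∂ν := by
  set y := |f s - f t| / (2 * b * r) with hy
  by_contra! hlt
  set I := ∫⁻ p, youngIncrement ψ f p ∂ν
  have hy0 : 0 ≤ y := by positivity
  have hmax : 0 < max (ψ y - 1) 0 := ENNReal.ofReal_pos.1 (pos_of_gt hlt)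
  have hψy : 1 < ψ y := by
    rcases lt_max_iff.1 hmax with h | h
    · linarith
    · exact absurd h (lt_irrefl _)
  have hy1 : 1 ≤ y := by
    by_contra! hy1
    linarith [hψ.le_self hψ1 hy0 hy1.le]
  rw [max_eq_left (by linarith)] at hlt
  have hI : ∫⁻ p, youngIncrement ψ (fun u => f u / (r * y)) p ∂ν ≤ ENNReal.ofReal (1 / ψ y) * I := by
    rw [← lintegral_const_mul' _ _ ENNReal.ofReal_ne_top]
    exact lintegral_mono fun p => youngIncrement_div_le hψ hψ1 hr hψr f hy1 p
  have hI1 : ENNReal.ofReal (1 / ψ y) * I < 1 := by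
    calc ENNReal.ofReal (1 / ψ y) * I ≤ ENNReal.ofReal (1 / ψ y) * ENNReal.ofReal (ψ y - 1) := by
          gcongr
      _ = ENNReal.ofReal (1 / ψ y * (ψ y - 1)) := (ENNReal.ofReal_mul (by positivity)).symm
      _ < 1 := by
          rw [ENNReal.ofReal_lt_one, one_div_mul_eq_div, div_lt_one (by linarith)]
          linarith
  have hdist : edist (f s / (r * y)) (f t / (r * y)) = ENNReal.ofReal b * 2 := by
    rw [edist_dist, Real.dist_eq, ← sub_div, abs_div, abs_of_pos (by positivity : 0 < r * y),
      ← ENNReal.ofReal_ofNat 2, ← ENNReal.ofReal_mul hb.le]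
    congr 1
    have : |f s - f t| = y * (2 * b * r) := by
      rw [hy, div_mul_cancel₀ _ (by positivity)]
    rw [this]
    field_simp
  have hfin := h (r * y)
  rw [hdist, ENNReal.mul_le_mul_iff_right (by simpa using hb) ENNReal.ofReal_ne_top] at hfin
  refine absurd hfin (not_le.2 ?_)
  rw [← one_add_one_eq_two]
  exact ENNReal.add_lt_add_left ENNReal.one_ne_top (hI.trans_lt hI1)

/-- Theorem 1, inequality (1.5) of the paper.  The value
`τ_{m,φ}(s,t)` (possibly infinite) is represented by any real `a > 0` with
`τ_{m,φ}(s,t) = a`. -/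
theorem statement1 (φ ψ : ℝ → ℝ) (hφ : IsYoungFunction φ) (hψ : IsYoungFunction ψ)
    (hφ1 : φ 1 = 1) (hψ1 : ψ 1 = 1) (R : ℝ) (hR : 1 < R) (n₀ : ℕ) (hn₀ : 1 ≤ n₀)
    (hmiau : ∀ k : ℕ, 1 ≤ k → φ (R ^ k) / φ (R ^ (k + 1)) ≤ φ (R ^ (k - 1)) / φ (R ^ k))
    (hpap : Summable fun k : ℕ => φ (R ^ k) / ψ (R ^ (k + n₀)))
    (r : ℝ) (hr : 1 < r)
    (hψr : ∀ x y : ℝ, 1 ≤ x → 1 ≤ y → ψ x * ψ y ≤ ψ (r * x * y)) :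
    ∃ K : ℝ, 0 < K ∧
      ∀ (T : Type) [MetricSpace T] [CompactSpace T] [MeasurableSpace T] [BorelSpace T]
        (m : Measure T), IsProbabilityMeasure m →
          ∃ ν : Measure (T × T), IsProbabilityMeasure ν ∧
            ∀ f : T → ℝ, Continuous f → ∀ s t : T, s ≠ t →
              ∀ a : ℝ, 0 < a → tauDist m φ s t = ENNReal.ofReal a →
                ENNReal.ofReal (max (ψ (|f s - f t| / (K * r * a)) - 1) 0) ≤
                  ∫⁻ p, ENNReal.ofReal (max (ψ (fdiv f p) - 1) 0) ∂ν := by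
  have hR0 : 1 ≤ R := hR.le
  have hR1 : ∀ k : ℕ, 1 ≤ R ^ k := fun k => one_le_pow₀ hR0
  have hφpos : ∀ k : ℕ, 0 < φ (R ^ k) := fun k => by linarith [hR1 k, hφ.self_le hφ1 (hR1 k)]
  have hψpos : ∀ k : ℕ, 0 < ψ (R ^ k) := fun k => by linarith [hR1 k, hψ.self_le hψ1 (hR1 k)]
  obtain ⟨p, hp⟩ := ((tendsto_pow_atTop_atTop_of_one_lt hR).eventually_ge_atTop 12).exists
  have hp1 : 1 ≤ p := by
    by_contra! h
    obtain rfl : p = 0 := by omega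
    norm_num at hp
  have hlog : ∀ k, φ (R ^ (k + 1)) * φ (R ^ (k + 1)) ≤ φ (R ^ (k + 2)) * φ (R ^ k) := fun k => by
    have := hmiau (k + 1) (by omega)
    rw [Nat.add_sub_cancel, div_le_div_iff₀ (hφpos _) (hφpos _)] at this
    linarith
  have hlogp : ∀ k, φ ((R ^ p) ^ (k + 1)) * φ ((R ^ p) ^ (k + 1)) ≤
      φ ((R ^ p) ^ (k + 2)) * φ ((R ^ p) ^ k) := fun k => by
    simp_rw [← pow_mul]
    exact mul_le_mul_of_logConvex hφpos hlog (Nat.mul_le_mul_left p (Nat.le_succ k)) p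
  have hsum : Summable fun k : ℕ => φ ((R ^ p) ^ (k + 1)) / ψ ((R ^ p) ^ (k + 1 + n₀)) := by
    have hinj : Function.Injective fun k : ℕ => p * (k + 1) := fun i j hij => by
      have := Nat.eq_of_mul_eq_mul_left (by omega : 0 < p) hij
      omega
    refine Summable.of_nonneg_of_le (fun k => ?_) (fun k => ?_) (hpap.comp_injective hinj)
    · simp_rw [← pow_mul]
      exact (div_pos (hφpos _) (hψpos _)).le
    · simp only [Function.comp_apply, ← pow_mul]
      have h1 : R ^ (p * (k + 1) + n₀) ≤ R ^ (p * (k + 1 + n₀)) :=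
        pow_le_pow_right₀ hR0 (by nlinarith)
      have h2 := hψ.1 (Set.mem_Ici.2 (by positivity)) (Set.mem_Ici.2 (by positivity)) h1
      exact div_le_div_of_nonneg_left (hφpos _).le (hψpos _) h2
  obtain ⟨C, hC, hmain⟩ := exists_measure_edist_le hφ hφ1 hψ hψ1 hp n₀ hlogp hsum
  refine ⟨2 * C, by positivity, ?_⟩
  intro T _ _ _ _ m hm
  obtain ⟨ν, hν, hf⟩ := hmain T m hm
  refine ⟨ν, hν, fun f hfc s t hst a ha hτ => ?_⟩
  have := ofReal_posPart_le_of_edist_le hψ hψ1 hr hψr (mul_pos hC ha) (s := s) (t := t) (f := f)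
    fun c => hf (fun u => f u / c) (hfc.div_const c) s t hst a ha hτ.le
  rwa [show 2 * (C * a) * r = 2 * C * r * a by ring] at this
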